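/- Let C ≥ 2 and let a be a positive integer coprime to C with a ≡ 3 (mod 4). Then there exists a constant c > 0 (depending on C) such that for every integer n ≥ 1, the n-th prime q with q ≡ a (mod C) exists and satisfies q^{3/2} · ( ∑_{0 ≠ I ⊆ O_K} N(I)^{−2} ) < c · (n · log(2n))^{3/2}, where K is the imaginary quadratic number field obtained from ℚ by adjoining a square root of −q, O_K is its ring of integers, and N denotes the absolute norm. -/

import Mathlib

open NumberField

theorem norm_sum_Ico_mul_le_of_antitoneOn {g : ℕ → ℂ} {f : ℕ → ℝ} {B : ℝ} {M N : ℕ}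
    (hg : ∀ n, ‖∑ i ∈ Finset.range n, g i‖ ≤ B) (hf : AntitoneOn f (Set.Ici M))
    (hf0 : 0 ≤ f N) (hMN : M ≤ N) :
    ‖∑ n ∈ Finset.Ico M N, g n * f n‖ ≤ 2 * B * f M := by
  have hdiff (m n : ℕ) : ‖∑ i ∈ Finset.range m, g i - ∑ i ∈ Finset.range n, g i‖ ≤ 2 * B :=
    (norm_sub_le _ _).trans (by linarith [hg m, hg n])
  have key : ‖∑ n ∈ Finset.Ico M N, g n * f n -
      (∑ i ∈ Finset.range N, g i - ∑ i ∈ Finset.range M, g i) * f N‖ ≤ 2 * B * (f M - f N) := by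
    clear hf0
    induction N, hMN using Nat.le_induction with
    | base => simp
    | succ N hN ih =>
      rw [Finset.sum_Ico_succ_top hN]
      have hstep : f (N + 1) ≤ f N := hf hN (Set.mem_Ici.2 (by omega)) (by omega)
      have heq : ∑ n ∈ Finset.Ico M N, g n * f n + g N * f N -
          (∑ i ∈ Finset.range (N + 1), g i - ∑ i ∈ Finset.range M, g i) * f (N + 1) =
          (∑ n ∈ Finset.Ico M N, g n * f n -
            (∑ i ∈ Finset.range N, g i - ∑ i ∈ Finset.range M, g i) * f N) +
          (∑ i ∈ Finset.range (N + 1), g i - ∑ i ∈ Finset.range M, g i) *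
            ((f N - f (N + 1) : ℝ) : ℂ) := by
        rw [Finset.sum_range_succ]; push_cast; ring
      rw [heq]
      refine (norm_add_le _ _).trans ?_
      have h2 : ‖(∑ i ∈ Finset.range (N + 1), g i - ∑ i ∈ Finset.range M, g i) *
            ((f N - f (N + 1) : ℝ) : ℂ)‖ ≤ 2 * B * (f N - f (N + 1)) := by
        rw [norm_mul, Complex.norm_real, Real.norm_of_nonneg (by linarith)]
        exact mul_le_mul_of_nonneg_right (hdiff _ _) (by linarith)
      linarith
  have h3 : ‖(∑ i ∈ Finset.range N, g i - ∑ i ∈ Finset.range M, g i) * (f N : ℂ)‖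
      ≤ 2 * B * f N := by
    rw [norm_mul, Complex.norm_real, Real.norm_of_nonneg hf0]
    exact mul_le_mul_of_nonneg_right (hdiff _ _) hf0
  calc _ = ‖(∑ n ∈ Finset.Ico M N, g n * f n -
      (∑ i ∈ Finset.range N, g i - ∑ i ∈ Finset.range M, g i) * f N) +
      (∑ i ∈ Finset.range N, g i - ∑ i ∈ Finset.range M, g i) * (f N : ℂ)‖ := by
        congr 1; ring
    _ ≤ _ := (norm_add_le _ _).trans (by linarith)

namespace DirichletCharacter

variable {C : ℕ} [NeZero C] {χ : DirichletCharacter ℂ C}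

theorem sum_range_add_level (hχ : χ ≠ 1) (N : ℕ) :
    ∑ n ∈ Finset.range (N + C), χ n = ∑ n ∈ Finset.range N, χ n := by
  induction N with
  | zero =>
    have h : ∑ n ∈ Finset.range C, χ (n : ZMod C) = ∑ x : ZMod C, χ x := by
      refine Finset.sum_bij' (fun n _ => (n : ZMod C)) (fun x _ => x.val) ?_ ?_ ?_ ?_ ?_
      · simp
      · intro x _; simpa using x.val_lt
      · intro n hn; exact ZMod.val_cast_of_lt (by simpa using hn)
      · simp
      · simp
    simpa [h] using MulChar.sum_eq_zero_of_ne_one hχ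
  | succ N ih =>
    rw [Nat.add_right_comm, Finset.sum_range_succ, ih, Finset.sum_range_succ]
    simp

theorem norm_sum_range_le (hχ : χ ≠ 1) (N : ℕ) : ‖∑ n ∈ Finset.range N, χ n‖ ≤ C := by
  induction N using Nat.strong_induction_on with
  | _ N ih =>
    rcases lt_or_ge N C with h | h
    · refine (norm_sum_le_of_le _ (n := fun _ => (1 : ℝ)) fun n _ => χ.norm_le_one _).trans ?_
      simpa using h.le
    · obtain ⟨M, rfl⟩ := Nat.exists_eq_add_of_le' h
      rw [sum_range_add_level hχ]
      exact ih M (by have := NeZero.pos C; omega)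

theorem norm_sum_rpow_sub_LFunction_le (hχ : χ ≠ 1) (N : ℕ) {s : ℝ} (hs : 1 < s) :
    ‖∑ n ∈ Finset.range (N + 1), χ n * ((n : ℝ) ^ (-s) : ℝ) - LFunction χ s‖ ≤
      2 * C * ((N + 1 : ℕ) : ℝ) ^ (-s) := by
  have hs' : 1 < (s : ℂ).re := by simpa using hs
  have hsum := (LSeriesSummable_of_one_lt_re χ hs').hasSum
  change HasSum _ (LSeries _ _) at hsum
  rw [← LFunction_eq_LSeries χ hs'] at hsum
  have hlim := hsum.tendsto_sum_nat
  have hterm (n : ℕ) : LSeries.term (fun n => χ n) s n = χ n * ((n : ℝ) ^ (-s) : ℝ) := by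
    rcases eq_or_ne n 0 with rfl | hn
    · simp [Real.zero_rpow (show -s ≠ 0 by linarith)]
    · rw [LSeries.term_of_ne_zero hn, Complex.ofReal_cpow (by positivity)]
      simp [Complex.cpow_neg, div_eq_mul_inv]
  simp_rw [hterm] at hlim
  refine le_of_tendsto (((tendsto_const_nhds (x := ∑ n ∈ Finset.range (N + 1),
    χ n * (((n : ℝ) ^ (-s) : ℝ) : ℂ))).sub hlim).norm) ?_
  filter_upwards [Filter.eventually_ge_atTop (N + 1)] with n hn
  rw [norm_sub_rev, ← Finset.sum_Ico_eq_sub _ hn]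
  refine norm_sum_Ico_mul_le_of_antitoneOn (norm_sum_range_le hχ) ?_ (by positivity) hn
  intro x hx y hy hxy
  have : 0 < x := lt_of_lt_of_le (Nat.succ_pos N) hx
  exact Real.rpow_le_rpow_of_nonpos (by exact_mod_cast this) (by exact_mod_cast hxy) (by linarith)

theorem norm_sum_div_sub_LFunction_one_le (hχ : χ ≠ 1) (N : ℕ) :
    ‖∑ n ∈ Finset.range (N + 1), χ n / n - LFunction χ 1‖ ≤ 2 * C / (N + 1) := by
  have h1 : Filter.Tendsto (fun s : ℝ => ‖∑ n ∈ Finset.range (N + 1),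
      χ n * (((n : ℝ) ^ (-s) : ℝ) : ℂ) - LFunction χ s‖) (nhdsWithin 1 (Set.Ioi 1))
      (nhds ‖∑ n ∈ Finset.range (N + 1), χ n / n - LFunction χ 1‖) := by
    refine Filter.Tendsto.norm (Filter.Tendsto.sub ?_ ?_)
    · refine tendsto_finsetSum _ fun n _ => ?_
      rw [div_eq_mul_inv]
      refine Filter.Tendsto.const_mul _ ?_
      have : ((n : ℂ))⁻¹ = (((n : ℝ) ^ (-(1 : ℝ)) : ℝ) : ℂ) := by
        rw [Real.rpow_neg_one]; simp
      rw [this]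
      refine (Complex.continuous_ofReal.tendsto _).comp ?_
      refine tendsto_nhdsWithin_of_tendsto_nhds ?_
      exact (Real.continuousAt_const_rpow' (by norm_num)).tendsto.comp
        (continuous_neg.tendsto _)
    · refine tendsto_nhdsWithin_of_tendsto_nhds ?_
      have hc := (differentiable_LFunction hχ).continuous.comp Complex.continuous_ofReal
      simpa [Function.comp_def] using hc.tendsto 1
  have h2 : Filter.Tendsto (fun s : ℝ => 2 * (C : ℝ) * ((N + 1 : ℕ) : ℝ) ^ (-s))
      (nhdsWithin 1 (Set.Ioi 1)) (nhds (2 * C / (N + 1))) := by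
    have : 2 * (C : ℝ) / (N + 1) = 2 * (C : ℝ) * ((N + 1 : ℕ) : ℝ) ^ (-(1 : ℝ)) := by
      rw [Real.rpow_neg_one, div_eq_mul_inv]; simp
    rw [this]
    refine tendsto_nhdsWithin_of_tendsto_nhds (Filter.Tendsto.const_mul _ ?_)
    exact (Real.continuousAt_const_rpow' (by norm_num)).tendsto.comp (continuous_neg.tendsto _)
  refine le_of_tendsto_of_tendsto h1 h2 ?_
  filter_upwards [self_mem_nhdsWithin] with s hs
  exact norm_sum_rpow_sub_LFunction_le hχ N hs

theorem exists_norm_sum_mul_log_div_le (hχ : χ ≠ 1) :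
    ∃ K : ℝ, ∀ N : ℕ, ‖∑ n ∈ Finset.range (N + 1), χ n * ((Real.log n / n : ℝ) : ℂ)‖ ≤ K := by
  have hanti : AntitoneOn (fun n : ℕ => Real.log n / n) (Set.Ici 3) := by
    intro x hx y hy hxy
    have he : Real.exp 1 ≤ 3 := Real.exp_one_lt_three.le
    exact Real.log_div_self_antitoneOn (he.trans (by exact_mod_cast hx))
      (he.trans (by exact_mod_cast hy)) (by exact_mod_cast hxy)
  refine ⟨Real.log 2 / 2 + 2 * C * (Real.log (3 : ℕ) / (3 : ℕ)), fun N => ?_⟩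
  have h0 (N : ℕ) : 0 ≤ Real.log N / N := div_nonneg (Real.log_natCast_nonneg _) (by positivity)
  have h3 (M : ℕ) (hM : M ≤ 3) :
      ‖∑ n ∈ Finset.range M, χ n * ((Real.log n / n : ℝ) : ℂ)‖ ≤ Real.log 2 / 2 := by
    refine (norm_sum_le_of_le _ (n := fun n : ℕ => Real.log n / n) fun n _ => ?_).trans ?_
    · rw [norm_mul, Complex.norm_real, Real.norm_of_nonneg (h0 n)]
      exact mul_le_of_le_one_left (h0 n) (χ.norm_le_one _)
    · refine (Finset.sum_le_sum_of_subset_of_nonneg (Finset.range_mono hM)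
        fun n _ _ => h0 n).trans ?_
      simp [Finset.sum_range_succ]
  rcases le_total (N + 1) 3 with h | h
  · refine (h3 _ h).trans (le_add_of_nonneg_right ?_)
    have := h0 3
    positivity
  · rw [← Finset.sum_range_add_sum_Ico _ h]
    exact (norm_add_le _ _).trans (add_le_add (h3 3 le_rfl)
      (norm_sum_Ico_mul_le_of_antitoneOn (norm_sum_range_le hχ) hanti (h0 _) h))

end DirichletCharacter

theorem sum_range_succ_eq_sum_Ioc {M : Type*} [AddCommMonoid M] {f : ℕ → M} (hf : f 0 = 0)
    (N : ℕ) : ∑ n ∈ Finset.range (N + 1), f n = ∑ n ∈ Finset.Ioc 0 N, f n := by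
  rw [Finset.range_eq_Ico, Finset.sum_eq_sum_Ico_succ_bot (Nat.succ_pos N), hf, zero_add]
  rfl

theorem Chebyshev.sum_vonMangoldt_Ioc_le (N : ℕ) :
    ∑ n ∈ Finset.Ioc 0 N, ArithmeticFunction.vonMangoldt n ≤ (Real.log 4 + 4) * N := by
  simpa [Chebyshev.psi] using Chebyshev.psi_le_const_mul_self (x := N) (by positivity)

theorem DirichletCharacter.sum_mul_log_div_eq {C : ℕ} (χ : DirichletCharacter ℂ C) (N : ℕ) :
    ∑ n ∈ Finset.Ioc 0 N, χ n * ((Real.log n / n : ℝ) : ℂ) =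
      ∑ d ∈ Finset.Ioc 0 N, (χ d * ((ArithmeticFunction.vonMangoldt d / d : ℝ) : ℂ)) *
        ∑ m ∈ Finset.Ioc 0 (N / d), χ m / m := by
  let F : ArithmeticFunction ℂ :=
    ⟨fun n => χ n * ((ArithmeticFunction.vonMangoldt n / n : ℝ) : ℂ), by simp⟩
  let G : ArithmeticFunction ℂ := ⟨fun n => χ n / n, by simp⟩
  have h := ArithmeticFunction.sum_Ioc_mul_eq_sum_sum F G N
  refine Eq.trans (Finset.sum_congr rfl fun n hn => ?_) h
  rw [ArithmeticFunction.mul_apply, ← ArithmeticFunction.vonMangoldt_sum,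
    ← Nat.sum_divisorsAntidiagonal (fun i _ => ArithmeticFunction.vonMangoldt i),
    Finset.sum_div, Complex.ofReal_sum, Finset.mul_sum]
  refine Finset.sum_congr rfl fun x hx => ?_
  obtain ⟨rfl, -⟩ := Nat.mem_divisorsAntidiagonal.1 hx
  simp only [F, G, ArithmeticFunction.coe_mk]
  push_cast
  rw [map_mul]
  simp only [div_eq_mul_inv, mul_inv]
  ring

theorem DirichletCharacter.exists_norm_sum_mul_vonMangoldt_div_le {C : ℕ} [NeZero C]
    {χ : DirichletCharacter ℂ C} (hχ : χ ≠ 1) :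
    ∃ K : ℝ, ∀ N : ℕ, ‖∑ n ∈ Finset.Ioc 0 N,
      χ n * ((ArithmeticFunction.vonMangoldt n / n : ℝ) : ℂ)‖ ≤ K := by
  obtain ⟨K, hK⟩ := exists_norm_sum_mul_log_div_le hχ
  have hL : LFunction χ 1 ≠ 0 := LFunction_apply_one_ne_zero hχ
  refine ⟨(K + 2 * C * (Real.log 4 + 4)) / ‖LFunction χ 1‖, fun N => ?_⟩
  rw [le_div_iff₀ (norm_pos_iff.2 hL), ← norm_mul]
  have hlog := hK N
  rw [sum_range_succ_eq_sum_Ioc (by simp), sum_mul_log_div_eq] at hlog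
  have hdiff : ‖∑ d ∈ Finset.Ioc 0 N,
      (χ d * ((ArithmeticFunction.vonMangoldt d / d : ℝ) : ℂ)) *
        (∑ m ∈ Finset.Ioc 0 (N / d), χ m / m - LFunction χ 1)‖ ≤
      2 * C * (Real.log 4 + 4) := by
    rcases Nat.eq_zero_or_pos N with rfl | hN
    · simp only [Finset.Ioc_self, Finset.sum_empty, norm_zero]
      have := Real.log_nonneg (show (1 : ℝ) ≤ 4 by norm_num)
      positivity
    have hN' : (0 : ℝ) < N := by exact_mod_cast hN
    refine (norm_sum_le_of_le _ (n := fun d : ℕ =>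
      ArithmeticFunction.vonMangoldt d * (2 * C / N)) fun d hd => ?_).trans ?_
    · have hd0 : 0 < d := (Finset.mem_Ioc.1 hd).1
      have hd0' : (0 : ℝ) < d := by exact_mod_cast hd0
      have hΛ : 0 ≤ ArithmeticFunction.vonMangoldt d := ArithmeticFunction.vonMangoldt_nonneg
      have hb := norm_sum_div_sub_LFunction_one_le hχ (N / d)
      rw [sum_range_succ_eq_sum_Ioc (by simp)] at hb
      have hfl : (N : ℝ) / d ≤ ((N / d : ℕ) : ℝ) + 1 := by
        rw [div_le_iff₀ hd0']
        have := (Nat.lt_mul_div_succ N hd0).le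
        rw [mul_comm]
        exact_mod_cast this
      have hb' : ‖∑ m ∈ Finset.Ioc 0 (N / d), χ m / m - LFunction χ 1‖ ≤ 2 * C * d / N := by
        refine hb.trans ?_
        rw [show 2 * (C : ℝ) * d / N = 2 * C / (N / d) by field_simp]
        gcongr
      rw [norm_mul, norm_mul, Complex.norm_real, Real.norm_of_nonneg (by positivity)]
      calc _ ≤ (1 * (ArithmeticFunction.vonMangoldt d / d)) * (2 * C * d / N) := by
            gcongr
            exact χ.norm_le_one _
        _ = _ := by field_simp
    · rw [← Finset.sum_mul]
      calc _ ≤ ((Real.log 4 + 4) * N) * (2 * C / N) := by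
            gcongr
            exact Chebyshev.sum_vonMangoldt_Ioc_le N
        _ = _ := by field_simp
  have heq : (∑ n ∈ Finset.Ioc 0 N,
      χ n * ((ArithmeticFunction.vonMangoldt n / n : ℝ) : ℂ)) * LFunction χ 1 =
      (∑ d ∈ Finset.Ioc 0 N, (χ d * ((ArithmeticFunction.vonMangoldt d / d : ℝ) : ℂ)) *
        ∑ m ∈ Finset.Ioc 0 (N / d), χ m / m) -
      ∑ d ∈ Finset.Ioc 0 N, (χ d * ((ArithmeticFunction.vonMangoldt d / d : ℝ) : ℂ)) *
        (∑ m ∈ Finset.Ioc 0 (N / d), χ m / m - LFunction χ 1) := by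
    rw [Finset.sum_mul, ← Finset.sum_sub_distrib]
    exact Finset.sum_congr rfl fun d _ => by ring
  rw [heq]
  exact (norm_sub_le _ _).trans (add_le_add hlog hdiff)

theorem ArithmeticFunction.abs_sum_vonMangoldt_div_sub_log_le {N : ℕ} (hN : N ≠ 0) :
    |∑ n ∈ Finset.Ioc 0 N, vonMangoldt n / n - Real.log N| ≤ Real.log 4 + 4 := by
  have hN' : (0 : ℝ) < N := by exact_mod_cast Nat.pos_of_ne_zero hN
  have hfact : Real.log (N.factorial) = ∑ n ∈ Finset.Ioc 0 N, vonMangoldt n * ((N / n : ℕ) : ℝ) := by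
    rw [← sum_Ioc_mul_zeta_eq_sum, vonMangoldt_mul_zeta]
    clear hN hN'
    induction N with
    | zero => simp
    | succ N ih =>
      rw [Finset.sum_Ioc_succ_top (Nat.zero_le _), ← ih, Nat.factorial_succ, Nat.cast_mul,
        Real.log_mul (by positivity) (by positivity), log_apply, add_comm]
  have hlower := Stirling.le_log_factorial_stirling hN
  have hpi : 0 ≤ Real.log (2 * Real.pi) := Real.log_nonneg (by linarith [Real.pi_gt_three])
  have hlogN : 0 ≤ Real.log N := Real.log_natCast_nonneg N
  have hupper : Real.log N.factorial ≤ N * Real.log N := by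
    rw [← Real.log_pow]
    exact Real.log_le_log (by positivity) (by exact_mod_cast Nat.factorial_le_pow N)
  have h1 : Real.log N.factorial ≤ N * ∑ n ∈ Finset.Ioc 0 N, vonMangoldt n / n := by
    rw [hfact, Finset.mul_sum]
    refine Finset.sum_le_sum fun n _ => ?_
    rw [mul_div_left_comm]
    exact mul_le_mul_of_nonneg_left Nat.cast_div_le vonMangoldt_nonneg
  have h2 : N * ∑ n ∈ Finset.Ioc 0 N, vonMangoldt n / n ≤
      Real.log N.factorial + ∑ n ∈ Finset.Ioc 0 N, vonMangoldt n := by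
    rw [hfact, Finset.mul_sum, ← Finset.sum_add_distrib]
    refine Finset.sum_le_sum fun n hn => ?_
    have hn0 := (Finset.mem_Ioc.1 hn).1
    rw [mul_div_left_comm, ← mul_add_one]
    refine mul_le_mul_of_nonneg_left ?_ vonMangoldt_nonneg
    rw [div_le_iff₀ (by exact_mod_cast hn0), mul_comm]
    exact_mod_cast (Nat.lt_mul_div_succ N hn0).le
  have hψ := Chebyshev.sum_vonMangoldt_Ioc_le N
  have h4 := Real.log_nonneg (show (1 : ℝ) ≤ 4 by norm_num)
  rw [abs_le]
  constructor <;> refine le_of_mul_le_mul_left ?_ hN' <;> nlinarith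

namespace ArithmeticFunction

theorem summable_vonMangoldt_non_primes_div :
    Summable fun n : ℕ => (if n.Prime then 0 else vonMangoldt n) / n := by
  refine (vonMangoldt.summable_residueClass_non_primes_div (0 : ZMod 1)).congr fun n => ?_
  have h : vonMangoldt.residueClass (0 : ZMod 1) n = vonMangoldt n := by
    simp [vonMangoldt.residueClass, eq_iff_true_of_subsingleton]
  rw [h]

theorem exists_norm_sum_one_mul_vonMangoldt_div_sub_log_le (C : ℕ) [NeZero C] :
    ∃ K : ℝ, ∀ N : ℕ, N ≠ 0 → ‖∑ n ∈ Finset.Ioc 0 N,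
      (1 : DirichletCharacter ℂ C) n * ((vonMangoldt n / n : ℝ) : ℂ) - (Real.log N : ℝ)‖ ≤ K := by
  let u : ℕ → ℝ := fun n => (if n.Prime then 0 else vonMangoldt n) / n
  let v : ℕ → ℝ := fun n => if n ∈ C.divisors then vonMangoldt n / n else 0
  have hΛ (n : ℕ) : 0 ≤ vonMangoldt n / n := div_nonneg vonMangoldt_nonneg (by positivity)
  have hu0 (n : ℕ) : 0 ≤ u n := by
    refine div_nonneg ?_ (by positivity)
    split_ifs
    exacts [le_rfl, vonMangoldt_nonneg]
  have hv0 (n : ℕ) : 0 ≤ v n := by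
    simp only [v]
    split_ifs
    exacts [hΛ n, le_rfl]
  have hu : Summable u := summable_vonMangoldt_non_primes_div
  have hv : Summable v := summable_of_ne_finset_zero (s := C.divisors) fun n hn => if_neg hn
  refine ⟨∑' n, (u n + v n) + (Real.log 4 + 4), fun N hN => ?_⟩
  have hsplit : ∑ n ∈ Finset.Ioc 0 N,
      (1 : DirichletCharacter ℂ C) n * ((vonMangoldt n / n : ℝ) : ℂ) - (Real.log N : ℝ) =
      ∑ n ∈ Finset.Ioc 0 N, ((1 : DirichletCharacter ℂ C) n - 1) *
        ((vonMangoldt n / n : ℝ) : ℂ) +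
      ((∑ n ∈ Finset.Ioc 0 N, vonMangoldt n / n - Real.log N : ℝ) : ℂ) := by
    simp only [sub_mul, one_mul, Finset.sum_sub_distrib]
    push_cast
    ring
  rw [hsplit]
  refine (norm_add_le _ _).trans (add_le_add ?_ ?_)
  · refine (norm_sum_le_of_le _ (n := fun n => u n + v n) fun n _ => ?_).trans
      ((hu.add hv).sum_le_tsum _ fun n _ => add_nonneg (hu0 n) (hv0 n))
    by_cases hn : IsUnit (n : ZMod C)
    · rw [MulChar.one_apply hn]
      simpa using add_nonneg (hu0 n) (hv0 n)
    · rw [MulChar.map_nonunit _ hn, zero_sub, neg_one_mul, norm_neg, Complex.norm_real,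
        Real.norm_of_nonneg (hΛ n)]
      by_cases hp : n.Prime
      · have hdvd : n ∣ C := by
          by_contra h
          exact hn ((ZMod.isUnit_iff_coprime n C).2 ((Nat.Prime.coprime_iff_not_dvd hp).2 h))
        have : v n = vonMangoldt n / n := if_pos (Nat.mem_divisors.2 ⟨hdvd, NeZero.ne C⟩)
        linarith [hu0 n]
      · have : u n = vonMangoldt n / n := by simp [u, hp]
        linarith [hv0 n]
  · rw [Complex.norm_real, Real.norm_eq_abs]
    exact abs_sum_vonMangoldt_div_sub_log_le hN

theorem exists_abs_sum_residueClass_div_sub_log_le {C : ℕ} [NeZero C] {a : ZMod C}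
    (ha : IsUnit a) :
    ∃ K : ℝ, ∀ N : ℕ, N ≠ 0 → |∑ n ∈ Finset.Ioc 0 N, vonMangoldt.residueClass a n / n -
      (C.totient : ℝ)⁻¹ * Real.log N| ≤ K := by
  classical
  have hbound (χ : DirichletCharacter ℂ C) : ∃ K : ℝ, ∀ N : ℕ, N ≠ 0 →
      ‖∑ n ∈ Finset.Ioc 0 N, χ n * ((vonMangoldt n / n : ℝ) : ℂ) -
        if χ = 1 then (Real.log N : ℂ) else 0‖ ≤ K := by
    by_cases hχ : χ = 1
    · subst hχ
      simpa using exists_norm_sum_one_mul_vonMangoldt_div_sub_log_le C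
    · obtain ⟨K, hK⟩ := DirichletCharacter.exists_norm_sum_mul_vonMangoldt_div_le hχ
      exact ⟨K, fun N _ => by simpa [hχ] using hK N⟩
  choose K hK using hbound
  refine ⟨(C.totient : ℝ)⁻¹ * ∑ χ, K χ, fun N hN => ?_⟩
  have hone : (1 : DirichletCharacter ℂ C) a⁻¹ = 1 :=
    MulChar.one_apply (by
      obtain ⟨w, rfl⟩ := ha
      rw [ZMod.inv_coe_unit]
      exact Units.isUnit _)
  have heq : ((∑ n ∈ Finset.Ioc 0 N, vonMangoldt.residueClass a n / n -
      (C.totient : ℝ)⁻¹ * Real.log N : ℝ) : ℂ) =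
      (C.totient : ℂ)⁻¹ * ∑ χ : DirichletCharacter ℂ C, χ a⁻¹ *
        (∑ n ∈ Finset.Ioc 0 N, χ n * ((vonMangoldt n / n : ℝ) : ℂ) -
          if χ = 1 then (Real.log N : ℂ) else 0) := by
    simp only [mul_sub, Finset.sum_sub_distrib, mul_ite, mul_zero, Finset.sum_ite_eq',
      Finset.mem_univ, if_true, hone, one_mul]
    push_cast
    congr 1
    rw [Finset.mul_sum]
    simp_rw [Finset.mul_sum]
    rw [Finset.sum_comm]
    refine Finset.sum_congr rfl fun n _ => ?_
    rw [vonMangoldt.residueClass_apply ha, Finset.mul_sum, Finset.sum_div]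
    exact Finset.sum_congr rfl fun χ _ => by ring
  rw [← Real.norm_eq_abs, ← Complex.norm_real, heq, norm_mul, norm_inv, Complex.norm_natCast]
  gcongr
  refine norm_sum_le_of_le _ fun χ _ => ?_
  rw [norm_mul]
  exact (mul_le_of_le_one_left (norm_nonneg _) (χ.norm_le_one _)).trans (hK χ N hN)

theorem exists_abs_sum_prime_residueClass_log_div_sub_log_le {C a : ℕ} [NeZero C]
    (ha : a.Coprime C) :
    ∃ K : ℝ, ∀ N : ℕ, N ≠ 0 →
      |∑ p ∈ Finset.Ioc 0 N with p.Prime ∧ p % C = a % C, Real.log p / p -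
        (C.totient : ℝ)⁻¹ * Real.log N| ≤ K := by
  obtain ⟨K, hK⟩ := exists_abs_sum_residueClass_div_sub_log_le ((ZMod.isUnit_iff_coprime a C).2 ha)
  have hs := vonMangoldt.summable_residueClass_non_primes_div (a : ZMod C)
  refine ⟨K + ∑' n : ℕ, (if n.Prime then 0 else vonMangoldt.residueClass (a : ZMod C) n) / n,
    fun N hN => ?_⟩
  have h0 (n : ℕ) : 0 ≤ (if n.Prime then 0 else vonMangoldt.residueClass (a : ZMod C) n) / n := by
    refine div_nonneg ?_ (by positivity)
    split_ifs
    exacts [le_rfl, vonMangoldt.residueClass_nonneg _ n]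
  have hle := hs.sum_le_tsum (Finset.Ioc 0 N) fun n _ => h0 n
  have hnn := Finset.sum_nonneg fun n (_ : n ∈ Finset.Ioc 0 N) => h0 n
  have hsplit : ∑ n ∈ Finset.Ioc 0 N, vonMangoldt.residueClass (a : ZMod C) n / n =
      ∑ p ∈ Finset.Ioc 0 N with p.Prime ∧ p % C = a % C, Real.log p / p +
      ∑ n ∈ Finset.Ioc 0 N, (if n.Prime then 0 else vonMangoldt.residueClass (a : ZMod C) n) / n := by
    rw [Finset.sum_filter, ← Finset.sum_add_distrib]
    refine Finset.sum_congr rfl fun n _ => ?_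
    by_cases hp : n.Prime
    · simp only [← ZMod.natCast_eq_natCast_iff']
      by_cases hna : (n : ZMod C) = a
      · simp [hp, hna, vonMangoldt.residueClass, vonMangoldt_apply_prime hp]
      · simp [hp, hna, vonMangoldt.residueClass]
    · simp [hp]
  have := hK N hN
  rw [hsplit] at this
  rw [abs_le] at this ⊢
  constructor <;> linarith

end ArithmeticFunction

theorem Nat.exists_le_mul_card_filter_prime_mod {C a : ℕ} [NeZero C] (ha : a.Coprime C) :
    ∃ T : ℕ, 2 ≤ T ∧ ∀ M : ℕ, 1 ≤ M →
      (M : ℝ) ≤ Nat.count (fun p => p.Prime ∧ p % C = a % C) (T * M + 1) *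
        Real.log (T * M : ℕ) := by
  obtain ⟨K, hK⟩ := ArithmeticFunction.exists_abs_sum_prime_residueClass_log_div_sub_log_le ha
  have hφ : (0 : ℝ) < (C.totient : ℝ)⁻¹ :=
    inv_pos.2 (by exact_mod_cast Nat.totient_pos.2 (NeZero.pos C))
  obtain ⟨T, hT2, hT⟩ : ∃ T : ℕ, 2 ≤ T ∧ 2 * K + 1 ≤ (C.totient : ℝ)⁻¹ * Real.log T := by
    have h := ((Real.tendsto_log_atTop.comp tendsto_natCast_atTop_atTop).const_mul_atTop hφ)
    obtain ⟨T, h1, h2⟩ := ((Filter.eventually_ge_atTop 2).and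
      (h.eventually_ge_atTop (2 * K + 1))).exists
    exact ⟨T, h1, h2⟩
  refine ⟨T, hT2, fun M hM => ?_⟩
  have hM0 : (0 : ℝ) < M := by exact_mod_cast hM
  have hT0 : (0 : ℝ) < T := by exact_mod_cast (by omega : 0 < T)
  have hTM : M ≤ T * M := Nat.le_mul_of_pos_left M (by omega)
  let P : ℕ → Prop := fun p => p.Prime ∧ p % C = a % C
  have h1 := abs_le.1 (hK M (by omega))
  have h2 := abs_le.1 (hK (T * M) (by positivity))
  have hlog : Real.log (T * M : ℕ) = Real.log T + Real.log M := by
    rw [Nat.cast_mul, Real.log_mul hT0.ne' hM0.ne']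
  have hsub : ∑ p ∈ Finset.Ioc 0 (T * M) with P p, Real.log p / p =
      ∑ p ∈ Finset.Ioc 0 M with P p, Real.log p / p +
      ∑ p ∈ Finset.Ioc M (T * M) with P p, Real.log p / p := by
    simp only [Finset.sum_filter]
    exact (Finset.sum_Ioc_consecutive _ (Nat.zero_le _) hTM).symm
  have hone : 1 ≤ ∑ p ∈ Finset.Ioc M (T * M) with P p, Real.log p / p := by
    rw [hlog] at h2
    have h2l := h2.1
    have h1u := h1.2
    change _ ≤ ∑ p ∈ Finset.Ioc 0 (T * M) with P p, Real.log p / p - _ at h2l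
    change ∑ p ∈ Finset.Ioc 0 M with P p, Real.log p / p - _ ≤ _ at h1u
    rw [hsub] at h2l
    linarith
  have hcard : ∑ p ∈ Finset.Ioc M (T * M) with P p, Real.log p / p ≤
      Nat.count P (T * M + 1) * (Real.log (T * M : ℕ) / M) := by
    refine (Finset.sum_le_card_nsmul _ _ (Real.log (T * M : ℕ) / M) fun p hp => ?_).trans ?_
    · simp only [Finset.mem_filter, Finset.mem_Ioc] at hp
      have hp0 : (0 : ℝ) < p := by exact_mod_cast hp.2.1.pos
      have : Real.log p ≤ Real.log (T * M : ℕ) :=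
        Real.log_le_log hp0 (by exact_mod_cast hp.1.2)
      have h0 : 0 ≤ Real.log p := Real.log_natCast_nonneg _
      have : (M : ℝ) ≤ p := by exact_mod_cast hp.1.1.le
      gcongr
    · rw [nsmul_eq_mul]
      have h0 : 0 ≤ Real.log (T * M : ℕ) / M :=
        div_nonneg (Real.log_natCast_nonneg _) hM0.le
      refine mul_le_mul_of_nonneg_right ?_ h0
      rw [Nat.count_eq_card_filter_range]
      refine Nat.cast_le.2 (Finset.card_le_card fun p hp => ?_)
      simp only [Finset.mem_filter, Finset.mem_Ioc, Finset.mem_range] at hp ⊢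
      exact ⟨by omega, hp.2⟩
  have := hone.trans hcard
  rwa [← mul_div_assoc, le_div_iff₀ hM0, one_mul] at this

theorem Nat.exists_nth_prime_mod_le {C a : ℕ} [NeZero C] (ha : a.Coprime C) :
    ∃ c : ℝ, 0 < c ∧ ∀ n : ℕ, 1 ≤ n →
      (Nat.nth (fun q => q.Prime ∧ q % C = a % C) (n - 1) : ℝ) ≤
        c * (n * Real.log (2 * n)) := by
  obtain ⟨T, hT2, hT⟩ := exists_le_mul_card_filter_prime_mod ha
  have hT0 : (0 : ℝ) < T := by exact_mod_cast (by omega : 0 < T)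
  have hinf : {q : ℕ | q.Prime ∧ q % C = a % C}.Infinite :=
    Nat.infinite_setOfPred_prime_and_modEq (NeZero.ne C) ha
  have hlog2 : 0 < Real.log 2 := Real.log_pos one_lt_two
  have hlogT : 0 ≤ Real.log (2 * T) := Real.log_nonneg (by
    have : (2 : ℝ) ≤ T := by exact_mod_cast hT2
    linarith)
  let A : ℝ := 2 * (Real.log (2 * T) / Real.log 2 + 1)
  have hA : 0 < A := by positivity
  refine ⟨T / Real.log 2 + 2 * T * A, by positivity, fun n hn => ?_⟩
  have hn1 : (1 : ℝ) ≤ n := by exact_mod_cast hn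
  have hlogn : Real.log 2 ≤ Real.log (2 * n) := Real.log_le_log two_pos (by linarith)
  set q := Nat.nth (fun q => q.Prime ∧ q % C = a % C) (n - 1) with hq
  have hcount : Nat.count (fun q => q.Prime ∧ q % C = a % C) q = n - 1 :=
    Nat.count_nth_of_infinite hinf _
  have hlogn0 : 0 ≤ Real.log (2 * n) := hlog2.le.trans hlogn
  have hnl : 0 ≤ n * Real.log (2 * n) := by positivity
  rcases lt_or_ge q T with hqT | hqT
  · have h1 : (q : ℝ) ≤ T := by exact_mod_cast hqT.le
    have h2 : (T : ℝ) ≤ T / Real.log 2 * (n * Real.log (2 * n)) := by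
      rw [div_mul_eq_mul_div, le_div_iff₀ hlog2]
      gcongr
      nlinarith
    have h3 : 0 ≤ 2 * T * A * (n * Real.log (2 * n)) := by positivity
    linarith
  · have hM : 1 ≤ q / T := (Nat.one_le_div_iff (by omega)).2 hqT
    have hTM : T * (q / T) ≤ q := Nat.mul_div_le q T
    have hq0 : (0 : ℝ) < q := by exact_mod_cast (by omega : 0 < q)
    have hlogq : 0 ≤ Real.log q := Real.log_natCast_nonneg _
    have hkey : (q : ℝ) ≤ 2 * T * n * Real.log q := by
      have h1 := hT _ hM
      have h2 : Nat.count (fun q => q.Prime ∧ q % C = a % C) (T * (q / T) + 1) ≤ n := by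
        refine (Nat.count_monotone _ (show T * (q / T) + 1 ≤ q + 1 by omega)).trans ?_
        rw [Nat.count_succ, hcount]
        split_ifs <;> omega
      have h3 : Real.log (T * (q / T) : ℕ) ≤ Real.log q :=
        Real.log_le_log (by exact_mod_cast Nat.mul_pos (show 0 < T by omega) hM)
          (by exact_mod_cast hTM)
      have h4 : ((q / T : ℕ) : ℝ) ≤ n * Real.log q :=
        h1.trans (mul_le_mul (by exact_mod_cast h2) h3 (Real.log_natCast_nonneg _) (by positivity))
      have h5 : q ≤ 2 * T * (q / T) := by
        have := Nat.lt_mul_div_succ q (show 0 < T by omega)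
        nlinarith
      calc (q : ℝ) ≤ 2 * T * (q / T : ℕ) := by exact_mod_cast h5
        _ ≤ 2 * T * (n * Real.log q) := by gcongr
        _ = _ := by ring
    have hsqrt : Real.sqrt q ≤ 2 * T * (2 * n) := by
      have h1 : Real.log q ≤ 2 * Real.sqrt q := by
        have := Real.log_le_sub_one_of_pos (Real.sqrt_pos.2 hq0)
        rw [Real.log_sqrt hq0.le] at this
        linarith
      have h2 : Real.sqrt q * Real.sqrt q ≤ 2 * T * (2 * n) * Real.sqrt q := by
        rw [Real.mul_self_sqrt hq0.le]
        calc (q : ℝ) ≤ 2 * T * n * Real.log q := hkey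
          _ ≤ 2 * T * n * (2 * Real.sqrt q) := by gcongr
          _ = _ := by ring
      exact le_of_mul_le_mul_right h2 (Real.sqrt_pos.2 hq0)
    have hlog : Real.log q ≤ A * Real.log (2 * n) := by
      have h1 := Real.log_le_log (Real.sqrt_pos.2 hq0) hsqrt
      rw [Real.log_sqrt hq0.le, Real.log_mul (by positivity) (by positivity)] at h1
      have h2 : Real.log (2 * T) ≤ Real.log (2 * T) / Real.log 2 * Real.log (2 * n) := by
        rw [div_mul_eq_mul_div, le_div_iff₀ hlog2]
        gcongr
      simp only [A]
      linarith
    calc (q : ℝ) ≤ 2 * T * n * Real.log q := hkey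
      _ ≤ 2 * T * n * (A * Real.log (2 * n)) := by gcongr
      _ = 2 * T * A * (n * Real.log (2 * n)) := by ring
      _ ≤ _ := mul_le_mul_of_nonneg_right (le_add_of_nonneg_left (by positivity)) hnl

theorem Ideal.card_primesOver_le_finrank {R : Type*} [CommRing R] [IsDomain R] (p : Ideal R)
    [p.IsPrime] (S : Type*) [CommRing S] [Algebra R S] [Module.Finite R S] [Module.Flat R S]
    [Fintype (p.primesOver S)] : Fintype.card (p.primesOver S) ≤ Module.finrank R S := by
  rw [← sum_ramification_inertia_eq_finrank p S, Fintype.card_eq_sum_ones]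
  refine Finset.sum_le_sum fun P _ => ?_
  have : P.1.IsPrime := P.2.1
  exact Nat.mul_pos (ramificationIdx_pos P.1 R) (inertiaDeg_pos P.1 R)

namespace NumberField

open UniqueFactorizationMonoid

variable {K : Type*} [Field K] [NumberField K]

theorem exists_bool_injOn_primes_over (hK : Module.finrank ℚ K ≤ 2) :
    ∃ e : Ideal (𝓞 K) → Bool, ∀ b, Set.InjOn
      (fun P : Ideal (𝓞 K) => Ideal.absNorm (P.under ℤ)) {P | Prime P ∧ e P = b} := by
  classical
  have hex (p : Ideal ℤ) : ∃ e : Ideal (𝓞 K) → Bool, Set.InjOn e (p.primesOver (𝓞 K)) := by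
    by_cases hp : p.IsPrime
    · have : Fintype (p.primesOver (𝓞 K)) := (Algebra.QuasiFinite.finite_primesOver p).fintype
      have hcard : Fintype.card (p.primesOver (𝓞 K)) ≤ Fintype.card Bool := by
        refine (Ideal.card_primesOver_le_finrank p (𝓞 K)).trans ?_
        rwa [RingOfIntegers.rank, Fintype.card_bool]
      obtain ⟨f⟩ := Function.Embedding.nonempty_of_card_le hcard
      refine ⟨fun P => if h : P ∈ p.primesOver (𝓞 K) then f ⟨P, h⟩ else true, ?_⟩
      intro P hP Q hQ h
      simpa [hP, hQ] using h
    · refine ⟨fun _ => true, fun P hP => absurd ?_ hp⟩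
      have := hP.1
      rw [hP.2.over]
      infer_instance
  choose e he using hex
  refine ⟨fun P => e (P.under ℤ) P, fun b P hP Q hQ hPQ => ?_⟩
  have hunder : P.under ℤ = Q.under ℤ := by
    rw [← Int.ideal_span_absNorm_eq_self (P.under ℤ), ← Int.ideal_span_absNorm_eq_self (Q.under ℤ)]
    simp only at hPQ
    rw [hPQ]
  refine he (P.under ℤ) ⟨Ideal.isPrime_of_prime hP.1, ⟨rfl⟩⟩
    ⟨Ideal.isPrime_of_prime hQ.1, ⟨hunder⟩⟩ ?_
  have h : e (P.under ℤ) P = e (Q.under ℤ) Q := hP.2.trans hQ.2.symm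
  rwa [← hunder] at h

theorem sum_absNorm_zpow_neg_two_le (hK : Module.finrank ℚ K ≤ 2) :
    ∑' I : {I : Ideal (𝓞 K) // I ≠ 0}, (Ideal.absNorm (I : Ideal (𝓞 K)) : ℝ) ^ (-2 : ℤ) ≤
      ∑' x : ℕ × ℕ, ((x.1 : ℝ) ^ 2)⁻¹ * ((x.2 : ℝ) ^ 2)⁻¹ := by
  classical
  obtain ⟨e, he⟩ := exists_bool_injOn_primes_over hK
  let π : Ideal (𝓞 K) → ℕ := fun P => Ideal.absNorm (P.under ℤ)
  have hπ (P : Ideal (𝓞 K)) (hP : Prime P) : (π P).Prime := by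
    have := Ideal.isPrime_of_prime hP
    have : NeZero P := ⟨hP.ne_zero⟩
    exact Nat.absNorm_under_prime P
  let part (b : Bool) (I : Ideal (𝓞 K)) : Multiset (Ideal (𝓞 K)) :=
    (normalizedFactors I).filter (fun P => e P = b)
  let m (b : Bool) (I : Ideal (𝓞 K)) : ℕ := ((part b I).map π).prod
  have hpart (b : Bool) (I P : Ideal (𝓞 K)) (hP : P ∈ part b I) : Prime P ∧ e P = b :=
    (Multiset.mem_filter.1 hP).imp_left (prime_of_normalized_factor P)
  have hadd (I : Ideal (𝓞 K)) : part true I + part false I = normalizedFactors I := by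
    have := Multiset.filter_add_not (fun P => e P = true) (normalizedFactors I)
    simpa [part] using this
  have hrec (b : Bool) (I : Ideal (𝓞 K)) :
      part b I = (normalizedFactors (m b I)).map (Function.invFunOn π {P | Prime P ∧ e P = b}) := by
    rw [normalizedFactors_prod_of_prime, Multiset.map_map]
    · refine (Multiset.map_id (part b I)).symm.trans (Multiset.map_congr rfl fun P hP => ?_)
      exact ((he b).leftInvOn_invFunOn (hpart b I P hP)).symm
    · intro p hp
      obtain ⟨P, hP, rfl⟩ := Multiset.mem_map.1 hp
      exact (hπ P (hpart b I P hP).1).prime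
  have hinj : Function.Injective
      (fun I : {I : Ideal (𝓞 K) // I ≠ 0} => (m true I.1, m false I.1)) := by
    rintro ⟨I, hI⟩ ⟨J, hJ⟩ h
    simp only [Prod.mk.injEq] at h
    refine Subtype.ext ?_
    change I = J
    rw [← Ideal.prod_normalizedFactors_eq_self hI, ← Ideal.prod_normalizedFactors_eq_self hJ,
      ← hadd I, ← hadd J, hrec true I, hrec false I, hrec true J, hrec false J, h.1, h.2]
  have hmpos (b : Bool) (I : Ideal (𝓞 K)) : 0 < m b I := by
    refine Nat.pos_of_ne_zero (Multiset.prod_ne_zero fun h => ?_)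
    obtain ⟨P, hP, h0⟩ := Multiset.mem_map.1 h
    exact (hπ P (hpart b I P hP).1).ne_zero h0
  have hnorm (I : Ideal (𝓞 K)) (hI : I ≠ 0) : m true I * m false I ≤ Ideal.absNorm I := by
    conv_rhs => rw [← Ideal.prod_normalizedFactors_eq_self hI, map_multiset_prod]
    simp only [m]
    rw [← Multiset.prod_add, ← Multiset.map_add, hadd]
    refine Multiset.prod_map_le_prod_map₀ _ _ (fun _ _ => Nat.zero_le _) fun P hP => ?_
    have hP0 : P ≠ 0 := (prime_of_normalized_factor P hP).ne_zero
    exact Nat.le_of_dvd (Nat.pos_of_ne_zero (Ideal.absNorm_eq_zero_iff.not.2 hP0))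
      (Int.absNorm_under_dvd_absNorm P)
  have hs : Summable fun n : ℕ => ((n : ℝ) ^ 2)⁻¹ := Real.summable_nat_pow_inv.2 one_lt_two
  have hs2 : Summable fun x : ℕ × ℕ => ((x.1 : ℝ) ^ 2)⁻¹ * ((x.2 : ℝ) ^ 2)⁻¹ :=
    hs.mul_of_nonneg hs (fun _ => by positivity) (fun _ => by positivity)
  refine Real.tsum_le_of_sum_le (fun _ => by positivity) fun s => ?_
  refine (Finset.sum_le_sum (g := fun I : {I : Ideal (𝓞 K) // I ≠ 0} =>
    ((m true I.1 : ℝ) ^ 2)⁻¹ * ((m false I.1 : ℝ) ^ 2)⁻¹) fun I _ => ?_).trans ?_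
  · rw [zpow_neg, ← mul_inv, ← mul_pow]
    have h1 : (0 : ℝ) < m true I.1 := by exact_mod_cast hmpos true I.1
    have h2 : (0 : ℝ) < m false I.1 := by exact_mod_cast hmpos false I.1
    have h3 : (m true I.1 * m false I.1 : ℝ) ≤ Ideal.absNorm I.1 := by
      exact_mod_cast hnorm I.1 I.2
    refine inv_anti₀ (by positivity) ?_
    exact pow_le_pow_left₀ (by positivity) h3 2
  · refine le_trans (le_of_eq ?_) (hs2.sum_le_tsum (s.map ⟨_, hinj⟩) fun _ _ => by positivity)
    rw [Finset.sum_map]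
    rfl

theorem finrank_le_two_of_sq_eq {α : K} {q : ℕ} (hα : α ^ 2 = -(q : K))
    (htop : IntermediateField.adjoin ℚ {α} = ⊤) : Module.finrank ℚ K ≤ 2 := by
  have hint : IsIntegral ℚ α := Algebra.IsIntegral.isIntegral α
  rw [← IntermediateField.finrank_top', ← htop, IntermediateField.adjoin.finrank hint]
  have h := minpoly.min ℚ α (p := Polynomial.X ^ 2 + Polynomial.C (q : ℚ))
    (Polynomial.monic_X_pow_add_C _ two_ne_zero) (by simp [hα])
  rw [Polynomial.degree_X_pow_add_C two_pos] at h
  exact Polynomial.natDegree_le_of_degree_le h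

end NumberField

/-- **Volume bound for the family in Theorem B.**
Let `C ≥ 2` and let `a` be a positive integer coprime to `C` with `a ≡ 3 (mod 4)`.
Then there is `c > 0` such that for every `n ≥ 1` the `n`-th prime `q ≡ a (mod C)`
exists, and for `K = ℚ(√−q)` we have
`q^{3/2} * ζ_K(2) < c * (n * log (2n))^{3/2}`, where
`ζ_K(2) = ∑_{0 ≠ I ⊆ O_K} N(I)^{-2}`. -/
theorem nth_prime_volume_bound
    (C a : ℕ) (hC : 2 ≤ C) (ha : 0 < a) (hcop : Nat.Coprime a C)
    (ha4 : a % 4 = 3) :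
    {q : ℕ | q.Prime ∧ q % C = a % C}.Infinite ∧
    ∃ c : ℝ, 0 < c ∧
      ∀ n : ℕ, 1 ≤ n →
        ∀ (K : Type) [Field K] [NumberField K] (α : K),
          α ^ 2 = -((Nat.nth (fun q => q.Prime ∧ q % C = a % C) (n - 1) : ℕ) : K) →
          IntermediateField.adjoin ℚ {α} = ⊤ →
          ((Nat.nth (fun q => q.Prime ∧ q % C = a % C) (n - 1) : ℝ) ^ ((3 : ℝ) / 2) *
              ∑' I : {I : Ideal (𝓞 K) // I ≠ 0},
                ((Ideal.absNorm (I : Ideal (𝓞 K)) : ℝ)) ^ (-2 : ℤ)) <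
            c * ((n : ℝ) * Real.log (2 * (n : ℝ))) ^ ((3 : ℝ) / 2) := by
  have : NeZero C := ⟨by omega⟩
  refine ⟨Nat.infinite_setOfPred_prime_and_modEq (NeZero.ne C) hcop, ?_⟩
  obtain ⟨c, hc, hbound⟩ := Nat.exists_nth_prime_mod_le hcop
  set Z : ℝ := ∑' x : ℕ × ℕ, ((x.1 : ℝ) ^ 2)⁻¹ * ((x.2 : ℝ) ^ 2)⁻¹ with hZ
  have hZ0 : 0 ≤ Z := tsum_nonneg fun _ => by positivity
  refine ⟨c ^ ((3 : ℝ) / 2) * Z + 1, by positivity, fun n hn K _ _ α hα htop => ?_⟩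
  have hn1 : (1 : ℝ) ≤ n := by exact_mod_cast hn
  have hlog : 0 < Real.log (2 * n) := Real.log_pos (by linarith)
  have hpos : 0 < (n * Real.log (2 * n)) ^ ((3 : ℝ) / 2) := by positivity
  have hζ := NumberField.sum_absNorm_zpow_neg_two_le
    (NumberField.finrank_le_two_of_sq_eq hα htop)
  have hq := Real.rpow_le_rpow (Nat.cast_nonneg _) (hbound n hn)
    (show (0 : ℝ) ≤ 3 / 2 by norm_num)
  rw [Real.mul_rpow hc.le (by positivity)] at hq
  calc _ ≤ (c ^ ((3 : ℝ) / 2) * (n * Real.log (2 * n)) ^ ((3 : ℝ) / 2)) * Z :=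
        mul_le_mul hq hζ (tsum_nonneg fun _ => by positivity) (by positivity)
    _ < _ := by linarith
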